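/- arXiv:1509.08208 — 5 statements merged into one kernel-verified Lean document; each statement's English description precedes it below -/
import Mathlib

section
/- Let k ≥ 1 and let G be a finite simple graph with minimum degree δ(G) ≥ k. Then γ_{×k,t}(G) ≥ k · ρ^open(G), where ρ^open(G) is the open packing number of G. -/
open SimpleGraph Set

/-- `S` is a `k`-tuple total dominating set (kTDS) of `G`: every vertex of `G`
has at least `k` neighbors in `S`. -/
def IsKTDS {V : Type*} (G : SimpleGraph V) (k : ℕ) (S : Set V) : Prop :=
  ∀ v : V, k ≤ (S ∩ G.neighborSet v).ncard

/-- The `k`-tuple total domination number `γ_{×k,t}(G)`: the minimum cardinality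
of a `k`-tuple total dominating set of `G`. -/
noncomputable def kTotalDomNum {V : Type*} [Fintype V] (G : SimpleGraph V) (k : ℕ) : ℕ :=
  sInf {n : ℕ | ∃ S : Set V, IsKTDS G k S ∧ S.ncard = n}

/-- A packing of `G`: a set of vertices whose closed neighborhoods are pairwise disjoint. -/
def IsPacking {V : Type*} (G : SimpleGraph V) (S : Set V) : Prop :=
  S.Pairwise fun u v => Disjoint (insert u (G.neighborSet u)) (insert v (G.neighborSet v))

/-- The packing number `ρ(G)`: the maximum cardinality of a packing of `G`. -/
noncomputable def packingNum {V : Type*} [Fintype V] (G : SimpleGraph V) : ℕ :=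
  sSup {n : ℕ | ∃ S : Set V, IsPacking G S ∧ S.ncard = n}

/-- An open packing of `G`: a set of vertices whose open neighborhoods are pairwise disjoint. -/
def IsOpenPacking {V : Type*} (G : SimpleGraph V) (S : Set V) : Prop :=
  S.Pairwise fun u v => Disjoint (G.neighborSet u) (G.neighborSet v)

/-- The open packing number `ρ^open(G)`: the maximum cardinality of an open packing of `G`. -/
noncomputable def openPackingNum {V : Type*} [Fintype V] (G : SimpleGraph V) : ℕ :=
  sSup {n : ℕ | ∃ S : Set V, IsOpenPacking G S ∧ S.ncard = n}

theorem IsOpenPacking.mul_ncard_le_ncard {V : Type*} [Finite V] {G : SimpleGraph V} {k : ℕ}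
    {P S : Set V} (hP : IsOpenPacking G P) (hS : IsKTDS G k S) : k * P.ncard ≤ S.ncard := by
  classical
  have := Fintype.ofFinite V
  have hdisj : (P.toFinset : Set V).PairwiseDisjoint
      fun v => (S ∩ G.neighborSet v).toFinset := by
    intro u hu v hv huv
    rw [Function.onFun, Set.disjoint_toFinset]
    exact (hP (by simpa using hu) (by simpa using hv) huv).mono
      Set.inter_subset_right Set.inter_subset_right
  calc k * P.ncard = ∑ _v ∈ P.toFinset, k := by
        rw [Finset.sum_const, smul_eq_mul, mul_comm, Set.ncard_eq_toFinset_card']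
    _ ≤ ∑ v ∈ P.toFinset, (S ∩ G.neighborSet v).toFinset.card :=
        Finset.sum_le_sum fun v _ => by
          rw [← Set.ncard_eq_toFinset_card']
          exact hS v
    _ = (P.toFinset.biUnion fun v => (S ∩ G.neighborSet v).toFinset).card :=
        (Finset.card_biUnion hdisj).symm
    _ ≤ S.toFinset.card := Finset.card_le_card <| Finset.biUnion_subset.2 fun _ _ =>
        Set.toFinset_subset_toFinset.2 Set.inter_subset_left
    _ = S.ncard := (Set.ncard_eq_toFinset_card' S).symm

theorem ktdn_ge_k_mul_openPackingNum {V : Type*} [Fintype V] (G : SimpleGraph V)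
    (k : ℕ) (hk : 1 ≤ k) (hδ : ∀ v : V, k ≤ (G.neighborSet v).ncard) :
    k * openPackingNum G ≤ kTotalDomNum G k := by
  have hpack : openPackingNum G ∈ {n : ℕ | ∃ P : Set V, IsOpenPacking G P ∧ P.ncard = n} := by
    refine Nat.sSup_mem ⟨0, ∅, Set.pairwise_empty _, Set.ncard_empty V⟩ ⟨Nat.card V, ?_⟩
    rintro _ ⟨P, -, rfl⟩
    exact Set.ncard_le_card P
  have hdom : kTotalDomNum G k ∈ {n : ℕ | ∃ S : Set V, IsKTDS G k S ∧ S.ncard = n} :=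
    Nat.sInf_mem ⟨_, Set.univ, fun v => by simpa only [Set.univ_inter] using hδ v, rfl⟩
  obtain ⟨P, hP, hPcard⟩ := hpack
  obtain ⟨S, hS, hScard⟩ := hdom
  rw [← hPcard, ← hScard]
  exact hP.mul_ncard_le_ncard hS
end

section
/- Let k ≥ 1 and let G and H be finite simple graphs with δ(H) ≥ k. Then ρ(G) · γ_{×k,t}(H) ≤ γ_{×k,t}(G □ H). -/
open SimpleGraph Set

theorem kTotalDomNum_le {V : Type*} [Fintype V] {G : SimpleGraph V} {k : ℕ} {S : Set V}
    (hS : IsKTDS G k S) : kTotalDomNum G k ≤ S.ncard :=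
  Nat.sInf_le ⟨S, hS, rfl⟩

theorem exists_isKTDS_ncard_eq {V : Type*} [Fintype V] {G : SimpleGraph V} {k : ℕ}
    (h : ∀ v, k ≤ (G.neighborSet v).ncard) :
    ∃ S : Set V, IsKTDS G k S ∧ S.ncard = kTotalDomNum G k :=
  Nat.sInf_mem (s := {n : ℕ | ∃ S : Set V, IsKTDS G k S ∧ S.ncard = n})
    ⟨_, Set.univ, fun v => by simpa using h v, rfl⟩

theorem exists_isPacking_ncard_eq {V : Type*} [Fintype V] (G : SimpleGraph V) :
    ∃ S : Set V, IsPacking G S ∧ S.ncard = packingNum G := by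
  refine Nat.sSup_mem (s := {n : ℕ | ∃ S : Set V, IsPacking G S ∧ S.ncard = n})
    ⟨_, ∅, Set.pairwise_empty _, rfl⟩ ⟨Nat.card V, ?_⟩
  rintro _ ⟨S, -, rfl⟩
  exact Set.ncard_le_card S

/-- A set lacking at most `c w` neighbors of each vertex `w` can be completed to a `k`-tuple total
dominating set by adding at most `∑ w, c w` vertices. -/
theorem kTotalDomNum_le_ncard_add_sum {W : Type*} [Fintype W] {H : SimpleGraph W} {k : ℕ}
    (hδ : ∀ w, k ≤ (H.neighborSet w).ncard) (S : Set W) (c : W → ℕ)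
    (hc : ∀ w, k ≤ (S ∩ H.neighborSet w).ncard + c w) :
    kTotalDomNum H k ≤ S.ncard + ∑ w, c w := by
  have key : ∀ w, ∃ A ⊆ H.neighborSet w \ S, A.ncard = k - (S ∩ H.neighborSet w).ncard := by
    intro w
    apply Set.exists_subset_card_eq
    have h := Set.ncard_inter_add_ncard_sdiff_eq_ncard (H.neighborSet w) S
    rw [Set.inter_comm] at h
    have := hδ w
    omega
  choose A hA hcard using key
  have hdom : IsKTDS H k (S ∪ ⋃ w, A w) := by
    intro w
    have hsub : (S ∩ H.neighborSet w) ∪ A w ⊆ (S ∪ ⋃ w, A w) ∩ H.neighborSet w := by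
      rintro x (hx | hx)
      · exact ⟨Or.inl hx.1, hx.2⟩
      · exact ⟨Or.inr (Set.mem_iUnion.2 ⟨w, hx⟩), (hA w hx).1⟩
    have hdisj : Disjoint (S ∩ H.neighborSet w) (A w) :=
      Set.disjoint_left.2 fun x hx hx' => (hA w hx').2 hx.1
    have h := Set.ncard_le_ncard hsub
    rw [Set.ncard_union_eq hdisj, hcard w] at h
    omega
  calc kTotalDomNum H k ≤ (S ∪ ⋃ w, A w).ncard := kTotalDomNum_le hdom
    _ ≤ S.ncard + (⋃ w, A w).ncard := Set.ncard_union_le _ _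
    _ ≤ S.ncard + ∑ w, (A w).ncard := by gcongr; exact Set.ncard_iUnion_le_of_fintype A
    _ ≤ S.ncard + ∑ w, c w := by
      gcongr with w
      have := hc w
      rw [hcard w]
      omega

open Classical in
/-- The part of a `k`-tuple total dominating set of `G □ H` lying over a closed neighborhood of `G`
has at least `kTotalDomNum H k` elements. -/
theorem kTotalDomNum_le_card_filter_fst {V W : Type*} [Fintype V] [Fintype W]
    {G : SimpleGraph V} {H : SimpleGraph W} {k : ℕ}
    (hδ : ∀ w, k ≤ (H.neighborSet w).ncard) {D : Finset (V × W)}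
    (hD : IsKTDS (G □ H) k (D : Set (V × W))) (u : V) :
    kTotalDomNum H k ≤ (D.filter fun p => p.1 ∈ insert u (G.neighborSet u)).card := by
  set L := D.filter fun p => p.1 = u
  set N := D.filter fun p => G.Adj u p.1
  have hLN : L.card + N.card = (D.filter fun p => p.1 ∈ insert u (G.neighborSet u)).card := by
    rw [← Finset.card_union_of_disjoint, ← Finset.filter_or]
    · rfl
    · refine Finset.disjoint_filter.2 fun p _ h h' => ?_
      rw [h] at h'
      exact G.irrefl h'
  have hN : N.card = ∑ w, (N.filter fun p => p.2 = w).card :=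
    Finset.card_eq_sum_card_fiberwise fun _ _ => Finset.mem_coe.2 (Finset.mem_univ _)
  have hmain := kTotalDomNum_le_ncard_add_sum hδ (↑(L.image Prod.snd))
    (fun w => (N.filter fun p => p.2 = w).card) fun w => by
      have hsub : (D : Set (V × W)) ∩ (G □ H).neighborSet (u, w) ⊆
          (fun x => (u, x)) '' (↑(L.image Prod.snd) ∩ H.neighborSet w) ∪
            ↑(N.filter fun p => p.2 = w) := by
        rintro ⟨a, b⟩ ⟨hp, hadj⟩
        rw [SimpleGraph.mem_neighborSet, SimpleGraph.boxProd_adj] at hadj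
        rcases hadj with ⟨h, h'⟩ | ⟨h, h'⟩
        · right
          simp_all [N]
        · left
          simp_all [L]
      calc k ≤ _ := hD (u, w)
        _ ≤ _ := Set.ncard_le_ncard hsub
        _ ≤ _ := Set.ncard_union_le _ _
        _ ≤ _ := by
          rw [Set.ncard_coe_finset]
          gcongr
          exact Set.ncard_image_le
  rw [Set.ncard_coe_finset, ← hN] at hmain
  have := Finset.card_image_le (s := L) (f := Prod.snd)
  omega

theorem packingNum_mul_ktdn_le_ktdn_boxProd {V W : Type*} [Fintype V] [Fintype W]
    (G : SimpleGraph V) (H : SimpleGraph W) (k : ℕ) (hk : 1 ≤ k)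
    (hδH : ∀ w : W, k ≤ (H.neighborSet w).ncard) :
    packingNum G * kTotalDomNum H k ≤ kTotalDomNum (G □ H) k := by
  classical
  obtain ⟨P, hP, hPcard⟩ := exists_isPacking_ncard_eq G
  have hδ : ∀ p, k ≤ ((G □ H).neighborSet p).ncard := by
    rintro ⟨u, w⟩
    refine (hδH w).trans ?_
    rw [← Set.ncard_image_of_injective _ (Prod.mk_right_injective u)]
    refine Set.ncard_le_ncard ?_
    rintro _ ⟨x, hx, rfl⟩
    exact SimpleGraph.boxProd_adj.2 (Or.inr ⟨hx, rfl⟩)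
  obtain ⟨D, hD, hDcard⟩ := exists_isKTDS_ncard_eq hδ
  lift P to Finset V using P.toFinite
  lift D to Finset (V × W) using D.toFinite
  rw [Set.ncard_coe_finset] at hPcard hDcard
  rw [← hPcard, ← hDcard]
  calc P.card * kTotalDomNum H k
      ≤ ∑ u ∈ P, (D.filter fun p => p.1 ∈ insert u (G.neighborSet u)).card := by
        rw [← smul_eq_mul]
        exact Finset.card_nsmul_le_sum _ _ _ fun u _ => kTotalDomNum_le_card_filter_fst hδH hD u
    _ = (P.biUnion fun u => D.filter fun p => p.1 ∈ insert u (G.neighborSet u)).card := by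
        refine (Finset.card_biUnion fun u hu v hv huv => ?_).symm
        exact Finset.disjoint_filter.2 fun p _ h h' =>
          Set.disjoint_left.1 (hP hu hv huv) h h'
    _ ≤ D.card := Finset.card_le_card <|
        Finset.biUnion_subset.2 fun u _ => Finset.filter_subset _ _
end

section
/- Let k ≥ 1, n ≥ 1, m ≥ 1, and identify the vertices of K_n □ K_m with pairs (i,j) for i ∈ {0,…,n−1}, j ∈ {0,…,m−1}. If D is a k-tuple total dominating set of K_n □ K_m and there exists a column index j* such that (i, j*) ∉ D for all i, then |D| ≥ k·n. -/
open SimpleGraph Set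

/-- If column `j` misses `D`, the neighbors in `D` of the vertex `(i, j)` all lie in row `i`. -/
lemma inter_neighborSet_subset_row {n m : ℕ} {D : Set (Fin n × Fin m)} {j : Fin m}
    (hj : ∀ i, (i, j) ∉ D) (i : Fin n) :
    D ∩ ((⊤ : SimpleGraph (Fin n)) □ (⊤ : SimpleGraph (Fin m))).neighborSet (i, j) ⊆
      {p ∈ D | p.1 = i} := by
  rintro ⟨a, b⟩ ⟨hab, hadj⟩
  rw [mem_neighborSet, boxProd_adj] at hadj
  obtain ⟨-, rfl⟩ | ⟨-, rfl⟩ := hadj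
  · exact absurd hab (hj a)
  · exact ⟨hab, rfl⟩

theorem ktds_with_zero_column_ge_kn (n m k : ℕ) (hk : 1 ≤ k) (hn : 1 ≤ n) (hm : 1 ≤ m)
    (D : Set (Fin n × Fin m))
    (hD : IsKTDS ((⊤ : SimpleGraph (Fin n)) □ (⊤ : SimpleGraph (Fin m))) k D)
    (hcol : ∃ j : Fin m, ∀ i : Fin n, (i, j) ∉ D) :
    k * n ≤ D.ncard := by
  classical
  obtain ⟨j, hj⟩ := hcol
  have hrow (i : Fin n) : k ≤ {p ∈ D.toFinset | p.1 = i}.card := by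
    refine (hD (i, j)).trans ((ncard_le_ncard (inter_neighborSet_subset_row hj i)).trans_eq ?_)
    rw [← ncard_coe_finset]
    congr 1
    ext p
    simp
  rw [ncard_eq_toFinset_card']
  simpa using Finset.mul_card_image_le_card_of_maps_to (s := D.toFinset) (t := Finset.univ)
    (f := Prod.fst) (by simp) k (fun i _ => hrow i)
end

section
/- Let k ≥ 1 and let n, m be integers with m ≥ n ≥ 2, m ≥ k, and m ≥ k·n − 1. Then γ_{×k,t}(K_n □ K_m) = k·n. -/
open SimpleGraph Set

/-- In a rook's graph, a row and a column through `v` together count every neighbor of `v` once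
and `v` itself twice. -/
theorem ncard_inter_neighborSet_rook {α β : Type*} [DecidableEq α] [DecidableEq β]
    (T : Finset (α × β)) (v : α × β) :
    ((T : Set (α × β)) ∩ ((⊤ : SimpleGraph α) □ (⊤ : SimpleGraph β)).neighborSet v).ncard
        + 2 * (if v ∈ T then 1 else 0)
      = (T.filter fun w => w.1 = v.1).card + (T.filter fun w => w.2 = v.2).card := by
  have hN : (T : Set (α × β)) ∩ ((⊤ : SimpleGraph α) □ (⊤ : SimpleGraph β)).neighborSet v
      = ((T.filter fun w => w.1 = v.1 ∨ w.2 = v.2) \ T.filter fun w => w = v : Finset (α × β)) := by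
    ext ⟨a, b⟩
    obtain ⟨c, d⟩ := v
    simp only [Set.mem_inter_iff, Finset.mem_coe, SimpleGraph.mem_neighborSet,
      SimpleGraph.boxProd_adj, SimpleGraph.top_adj, Finset.mem_sdiff, Finset.mem_filter,
      Prod.mk.injEq]
    grind
  have hsub : (T.filter fun w => w = v) ⊆ T.filter fun w => w.1 = v.1 ∨ w.2 = v.2 := by
    grind
  have hpoint : (T.filter fun w => w = v).card = if v ∈ T then 1 else 0 := by
    rw [Finset.filter_eq']
    split_ifs <;> simp
  have hinter : (T.filter fun w => w = v)
      = (T.filter fun w => w.1 = v.1) ∩ T.filter fun w => w.2 = v.2 := by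
    ext w
    simp only [Finset.mem_inter, Finset.mem_filter, Prod.ext_iff]
    tauto
  have hcount := Finset.card_union_add_card_inter
    (T.filter fun w => w.1 = v.1) (T.filter fun w => w.2 = v.2)
  rw [← Finset.filter_or, ← hinter] at hcount
  have hdiff := Finset.card_sdiff_add_card_eq_card hsub
  rw [hN, Set.ncard_coe_finset, ← hcount, ← hdiff, hpoint]
  ring

/-- The set of all vertices in `k` fixed columns is a `k`-tuple total dominating set of the
rook's graph with at least two rows. -/
theorem isKTDS_univ_product {α β : Type*} [Fintype α] [DecidableEq α] [DecidableEq β]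
    (hα : 2 ≤ Fintype.card α) (J : Finset β) :
    IsKTDS ((⊤ : SimpleGraph α) □ (⊤ : SimpleGraph β)) J.card
      ((Finset.univ ×ˢ J : Finset (α × β)) : Set (α × β)) := by
  intro v
  have h := ncard_inter_neighborSet_rook (Finset.univ ×ˢ J) v
  have hrow : ((Finset.univ ×ˢ J).filter fun w : α × β => w.1 = v.1) = {v.1} ×ˢ J := by
    ext w
    simp only [Finset.mem_filter, Finset.mem_product, Finset.mem_univ, true_and,
      Finset.mem_singleton, and_comm]
  rw [hrow, Finset.card_product, Finset.card_singleton, one_mul] at h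
  split_ifs at h with hv
  · have hcol : ((Finset.univ ×ˢ J).filter fun w : α × β => w.2 = v.2)
        = Finset.univ ×ˢ {v.2} := by
      ext w
      simp only [Finset.mem_product, Finset.mem_univ, true_and] at hv
      simp only [Finset.mem_filter, Finset.mem_product, Finset.mem_univ, true_and,
        Finset.mem_singleton]
      exact ⟨And.right, fun hw => ⟨hw ▸ hv, hw⟩⟩
    rw [hcol, Finset.card_product, Finset.card_singleton, Finset.card_univ] at h
    omega
  · omega

/-- Summing the domination condition over the row `i`. -/
theorem card_mul_le_of_isKTDS {α β : Type*} [DecidableEq α] [DecidableEq β]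
    [Fintype β] {k : ℕ} {T : Finset (α × β)}
    (hT : IsKTDS ((⊤ : SimpleGraph α) □ (⊤ : SimpleGraph β)) k (T : Set (α × β))) (i : α) :
    Fintype.card β * k + 2 * (T.filter fun w => w.1 = i).card
      ≤ Fintype.card β * (T.filter fun w => w.1 = i).card + T.card := by
  have hrow : (T.filter fun w => w.1 = i).card = ∑ j : β, if (i, j) ∈ T then 1 else 0 := by
    rw [← Finset.card_filter]
    refine Finset.card_bij' (fun w _ => w.2) (fun j _ => (i, j)) ?_ ?_ ?_ ?_ <;> grind
  have hcol : T.card = ∑ j : β, (T.filter fun w => w.2 = j).card :=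
    Finset.card_eq_sum_card_fiberwise fun _ _ => Finset.mem_coe.2 (Finset.mem_univ _)
  have hsum := Finset.sum_le_sum fun (j : β) (_ : j ∈ Finset.univ) =>
    (Nat.add_le_add_right (hT (i, j)) _).trans_eq (ncard_inter_neighborSet_rook T (i, j))
  simpa only [Finset.sum_add_distrib, ← Finset.mul_sum, ← hrow, ← hcol, Finset.sum_const,
    Finset.card_univ, smul_eq_mul] using hsum

theorem ktdn_rook_eq_kn (n m k : ℕ) (hk : 1 ≤ k) (hn : 2 ≤ n) (hnm : n ≤ m)
    (hkm : k ≤ m) (hm : k * n - 1 ≤ m) :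
    kTotalDomNum ((⊤ : SimpleGraph (Fin n)) □ (⊤ : SimpleGraph (Fin m))) k = k * n := by
  classical
  obtain ⟨J, -, hJ⟩ := Finset.exists_subset_card_eq
    (s := (Finset.univ : Finset (Fin m))) (n := k) (by simpa using hkm)
  have hcols : k * n ∈ {c : ℕ | ∃ S : Set (Fin n × Fin m),
      IsKTDS ((⊤ : SimpleGraph (Fin n)) □ (⊤ : SimpleGraph (Fin m))) k S ∧ S.ncard = c} := by
    refine ⟨_, hJ ▸ isKTDS_univ_product (by simpa using hn) J, ?_⟩
    rw [Set.ncard_coe_finset, Finset.card_product, Finset.card_univ, Fintype.card_fin, hJ,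
      mul_comm]
  refine le_antisymm (Nat.sInf_le hcols) (le_csInf ⟨_, hcols⟩ ?_)
  rintro _ ⟨S, hS, rfl⟩
  lift S to Finset (Fin n × Fin m) using S.toFinite
  rw [Set.ncard_coe_finset]
  by_contra! hlt
  obtain ⟨i, -, hi⟩ := Finset.exists_card_fiber_lt_of_card_lt_mul (s := S)
    (t := (Finset.univ : Finset (Fin n))) (f := Prod.fst) (n := k)
    (by simpa [mul_comm] using hlt)
  have hle := card_mul_le_of_isKTDS hS i
  rw [Fintype.card_fin] at hle
  rcases Nat.eq_zero_or_pos (S.filter fun w => w.1 = i).card with hr | hr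
  · rw [hr] at hle
    have := Nat.mul_le_mul_left k hnm
    linarith
  · have := Nat.mul_le_mul_left m (Nat.succ_le_of_lt hi)
    rw [Nat.succ_eq_add_one, mul_add_one] at this
    omega
end

section
/- Let n ≥ 2 be an integer. Then γ_{×2,t}(K_n □ K_n) = ⌈3n/2⌉ + 1 if n ≡ 2 (mod 4), and γ_{×2,t}(K_n □ K_n) = ⌈3n/2⌉ otherwise. -/
open SimpleGraph Set

open Finset in
theorem sum_inv_card_fiber {α β : Type*} [Fintype β] [DecidableEq β] (S : Finset α) (f : α → β)
    (h : ∀ b, 0 < #{a ∈ S | f a = b}) :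
    ∑ a ∈ S, ((#{x ∈ S | f x = f a} : ℕ) : ℚ)⁻¹ = Fintype.card β := by
  rw [← Finset.sum_fiberwise S f]
  have : ∀ b, ∑ a ∈ S with f a = b, ((#{x ∈ S | f x = f a} : ℕ) : ℚ)⁻¹ = 1 := by
    intro b
    rw [Finset.sum_congr rfl (g := fun _ => ((#{x ∈ S | f x = b} : ℕ) : ℚ)⁻¹)]
    · have := h b
      rw [Finset.sum_const, nsmul_eq_mul, mul_inv_cancel₀]
      exact_mod_cast this.ne'
    · intro a ha
      rw [(Finset.mem_filter.1 ha).2]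
  simp [this]

theorem inv_add_inv_le_four_thirds {r c : ℕ} (hr : 0 < r) (hc : 0 < c) (h : 4 ≤ r + c) :
    (r : ℚ)⁻¹ + (c : ℚ)⁻¹ ≤ 4 / 3 ∧
      ((r : ℚ)⁻¹ + (c : ℚ)⁻¹ = 4 / 3 → r = 1 ∨ r = 3) := by
  have hr' : (0 : ℚ) < r := by exact_mod_cast hr
  have hc' : (0 : ℚ) < c := by exact_mod_cast hc
  have e : (r : ℚ)⁻¹ + (c : ℚ)⁻¹ = (3 * (r + c) : ℕ) / (3 * (r * c) : ℕ) := by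
    push_cast
    field_simp
    ring
  have hp : (0 : ℚ) < (3 * (r * c) : ℕ) := by positivity
  rw [e, div_le_iff₀ hp, div_eq_iff hp.ne']
  have key : 3 * (r + c) ≤ 4 * (r * c) ∧ (3 * (r + c) = 4 * (r * c) → r = 1 ∨ r = 3) := by
    obtain rfl | hr2 := (show 1 ≤ r from hr).eq_or_lt
    · omega
    obtain rfl | hc2 := (show 1 ≤ c from hc).eq_or_lt
    · omega
    obtain ⟨a, rfl⟩ := Nat.exists_eq_add_of_le hr2
    obtain ⟨b, rfl⟩ := Nat.exists_eq_add_of_le hc2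
    constructor
    · nlinarith
    · intro h
      nlinarith
  have e4 : (4 / 3 : ℚ) * (3 * (r * c) : ℕ) = (4 * (r * c) : ℕ) := by
    push_cast
    ring
  rw [e4]
  exact_mod_cast key

open Finset in
theorem IsKTDS.two_le_card_row_erase_add_card_col_erase {n : ℕ} {S : Finset (Fin n × Fin n)}
    (h : IsKTDS ((⊤ : SimpleGraph (Fin n)) □ (⊤ : SimpleGraph (Fin n))) 2 (S : Set (Fin n × Fin n)))
    (v : Fin n × Fin n) :
    2 ≤ #({p ∈ S | p.1 = v.1}.erase v) + #({p ∈ S | p.2 = v.2}.erase v) := by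
  refine (h v).trans (le_trans ?_ (Finset.card_union_le _ _))
  rw [← Set.ncard_coe_finset]
  refine Set.ncard_le_ncard ?_ (Finset.finite_toSet _)
  rintro p ⟨hp, hvp⟩
  rw [SimpleGraph.mem_neighborSet] at hvp
  have hne : p ≠ v := hvp.ne.symm
  rw [SimpleGraph.boxProd_adj] at hvp
  rw [Finset.mem_coe] at hp ⊢
  simp only [Finset.mem_union, Finset.mem_erase, Finset.mem_filter]
  obtain h | h := hvp
  · exact Or.inr ⟨hne, hp, h.2.symm⟩
  · exact Or.inl ⟨hne, hp, h.2.symm⟩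

open Finset in
theorem IsKTDS.rook_card_bound {n : ℕ} (hn : 2 ≤ n) {S : Finset (Fin n × Fin n)}
    (h : IsKTDS ((⊤ : SimpleGraph (Fin n)) □ (⊤ : SimpleGraph (Fin n))) 2
      (S : Set (Fin n × Fin n))) :
    3 * n ≤ 2 * #S ∧ (n % 4 = 2 → 3 * n + 2 ≤ 2 * #S) := by
  have hv := h.two_le_card_row_erase_add_card_col_erase
  have hrow : #S = ∑ i, #{p ∈ S | p.1 = i} :=
    Finset.card_eq_sum_card_fiberwise fun _ _ => Finset.mem_coe.2 (Finset.mem_univ _)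
  have hcol : #S = ∑ j, #{p ∈ S | p.2 = j} :=
    Finset.card_eq_sum_card_fiberwise fun _ _ => Finset.mem_coe.2 (Finset.mem_univ _)
  have hsum (i j : Fin n) : 2 ≤ #{p ∈ S | p.1 = i} + #{p ∈ S | p.2 = j} :=
    (hv (i, j)).trans (add_le_add (Finset.card_erase_le) (Finset.card_erase_le))
  have hlarge (f : Fin n → ℕ) (hf : #S = ∑ i, f i) (hf2 : ∀ i, 2 ≤ f i) : 2 * n ≤ #S := by
    have := Finset.card_nsmul_le_sum univ f 2 fun i _ => hf2 i
    rw [← hf, Finset.card_univ, Fintype.card_fin, smul_eq_mul] at this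
    omega
  by_cases hr : ∀ i, 0 < #{p ∈ S | p.1 = i}
  swap
  · push Not at hr
    obtain ⟨i, hi⟩ := hr
    have := hlarge _ hcol fun j => by have := hsum i j; omega
    omega
  by_cases hc : ∀ j, 0 < #{p ∈ S | p.2 = j}
  swap
  · push Not at hc
    obtain ⟨j, hj⟩ := hc
    have := hlarge _ hrow fun i => by have := hsum i j; omega
    omega
  have hedge : ∀ p ∈ S, 4 ≤ #{q ∈ S | q.1 = p.1} + #{q ∈ S | q.2 = p.2} := by
    intro p hp
    have := hv p
    rw [Finset.card_erase_of_mem (by simp [hp]), Finset.card_erase_of_mem (by simp [hp])] at this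
    have := hr p.1
    have := hc p.2
    omega
  have hw p (hp : p ∈ S) := inv_add_inv_le_four_thirds (hr p.1) (hc p.2) (hedge p hp)
  have htotal : ∑ p ∈ S, (((#{q ∈ S | q.1 = p.1} : ℕ) : ℚ)⁻¹ +
      ((#{q ∈ S | q.2 = p.2} : ℕ) : ℚ)⁻¹) = 2 * n := by
    rw [Finset.sum_add_distrib, sum_inv_card_fiber S Prod.fst hr, sum_inv_card_fiber S Prod.snd hc,
      Fintype.card_fin]
    ring
  have hconst : ∑ _p ∈ S, (4 / 3 : ℚ) = 4 / 3 * #S := by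
    rw [Finset.sum_const, nsmul_eq_mul, mul_comm]
  have hbound : 3 * n ≤ 2 * #S := by
    have := Finset.sum_le_sum fun p hp => (hw p hp).1
    rw [htotal, hconst] at this
    have : (3 * n : ℚ) ≤ 2 * #S := by linarith
    exact_mod_cast this
  refine ⟨hbound, fun hmod => ?_⟩
  by_contra! hlt
  have heq : 3 * n = 2 * #S := by omega
  have htight : ∀ p ∈ S, ((#{q ∈ S | q.1 = p.1} : ℕ) : ℚ)⁻¹ +
      ((#{q ∈ S | q.2 = p.2} : ℕ) : ℚ)⁻¹ = 4 / 3 := by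
    rw [← Finset.sum_eq_sum_iff_of_le fun p hp => (hw p hp).1, htotal, hconst]
    have : (3 * n : ℚ) = 2 * #S := by exact_mod_cast heq
    linarith
  have hcount : #S = n + 2 * #{i | #{p ∈ S | p.1 = i} = 3} := by
    rw [hrow, Finset.sum_congr rfl
      (g := fun i => 1 + 2 * if #{p ∈ S | p.1 = i} = 3 then 1 else 0)]
    · rw [Finset.sum_add_distrib, ← Finset.mul_sum, ← Finset.card_filter]
      simp
    · intro i _
      obtain ⟨p, hp⟩ := Finset.card_pos.1 (hr i)
      obtain ⟨hpS, rfl⟩ := Finset.mem_filter.1 hp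
      obtain h | h := (hw p hpS).2 (htight p hpS) <;> simp [h]
  omega

/-- A certificate that `S` is a 2-tuple total dominating set of the `n × n` rook's graph: `S` meets
every row and column, and every cell of `S` has two neighbors in `S`. -/
structure IsRookCover (n : ℕ) (S : Finset (ℕ × ℕ)) : Prop where
  subset : ∀ p ∈ S, p.1 < n ∧ p.2 < n
  row : ∀ i < n, ∃ p ∈ S, p.1 = i
  col : ∀ j < n, ∃ p ∈ S, p.2 = j
  two : ∀ p ∈ S, ∃ q ∈ S, ∃ r ∈ S, q ≠ r ∧ q ≠ p ∧ r ≠ p ∧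
    (q.1 = p.1 ∨ q.2 = p.2) ∧ (r.1 = p.1 ∨ r.2 = p.2)

open Finset in
theorem IsRookCover.exists_add_four {n m : ℕ} (h : ∃ S, IsRookCover n S ∧ #S = m) :
    ∃ S, IsRookCover (n + 4) S ∧ #S = m + 6 := by
  obtain ⟨S, hS, rfl⟩ := h
  let T : Finset (ℕ × ℕ) :=
    {(n, n), (n, n + 1), (n, n + 2), (n + 1, n + 3), (n + 2, n + 3), (n + 3, n + 3)}
  have hT : ∀ p, p ∈ T ↔ p = (n, n) ∨ p = (n, n + 1) ∨ p = (n, n + 2) ∨ p = (n + 1, n + 3) ∨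
      p = (n + 2, n + 3) ∨ p = (n + 3, n + 3) := by simp [T]
  have hcard : #T = 6 := by simp [T, Finset.card_insert_of_notMem]
  have hdisj : Disjoint S T := by
    rw [Finset.disjoint_left]
    intro p hp hpT
    have := hS.subset p hp
    obtain rfl | rfl | rfl | rfl | rfl | rfl := (hT p).1 hpT <;> simp at this
  refine ⟨S ∪ T, ⟨?_, ?_, ?_, ?_⟩, by rw [Finset.card_union_of_disjoint hdisj, hcard]⟩
  · intro p hp
    obtain hp | hp := Finset.mem_union.1 hp
    · have := hS.subset p hp
      omega
    · obtain rfl | rfl | rfl | rfl | rfl | rfl := (hT p).1 hp <;> simp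
  · intro i hi
    by_cases hin : i < n
    · obtain ⟨p, hp, hpi⟩ := hS.row i hin
      exact ⟨p, Finset.mem_union_left _ hp, hpi⟩
    · obtain rfl | rfl | rfl | rfl : i = n ∨ i = n + 1 ∨ i = n + 2 ∨ i = n + 3 := by omega
      · exact ⟨(i, i), Finset.mem_union_right _ (by simp [hT]), rfl⟩
      all_goals exact ⟨(_, n + 3), Finset.mem_union_right _ (by simp [hT]), rfl⟩
  · intro j hj
    by_cases hjn : j < n
    · obtain ⟨p, hp, hpj⟩ := hS.col j hjn
      exact ⟨p, Finset.mem_union_left _ hp, hpj⟩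
    · obtain rfl | rfl | rfl | rfl : j = n ∨ j = n + 1 ∨ j = n + 2 ∨ j = n + 3 := by omega
      · exact ⟨(j, j), Finset.mem_union_right _ (by simp [hT]), rfl⟩
      · exact ⟨(n, n + 1), Finset.mem_union_right _ (by simp [hT]), rfl⟩
      · exact ⟨(n, n + 2), Finset.mem_union_right _ (by simp [hT]), rfl⟩
      · exact ⟨(n + 3, n + 3), Finset.mem_union_right _ (by simp [hT]), rfl⟩
  · intro p hp
    obtain hp | hp := Finset.mem_union.1 hp
    · obtain ⟨q, hq, r, hr, hqr⟩ := hS.two p hp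
      exact ⟨q, Finset.mem_union_left _ hq, r, Finset.mem_union_left _ hr, hqr⟩
    · suffices ∃ q ∈ T, ∃ r ∈ T, q ≠ r ∧ q ≠ p ∧ r ≠ p ∧
          (q.1 = p.1 ∨ q.2 = p.2) ∧ (r.1 = p.1 ∨ r.2 = p.2) by
        obtain ⟨q, hq, r, hr, hqr⟩ := this
        exact ⟨q, Finset.mem_union_right _ hq, r, Finset.mem_union_right _ hr, hqr⟩
      obtain rfl | rfl | rfl | rfl | rfl | rfl := (hT p).1 hp
      · exact ⟨(n, n + 1), by simp [hT], (n, n + 2), by simp [hT], by simp⟩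
      · exact ⟨(n, n), by simp [hT], (n, n + 2), by simp [hT], by simp⟩
      · exact ⟨(n, n), by simp [hT], (n, n + 1), by simp [hT], by simp⟩
      · exact ⟨(n + 2, n + 3), by simp [hT], (n + 3, n + 3), by simp [hT], by simp⟩
      · exact ⟨(n + 1, n + 3), by simp [hT], (n + 3, n + 3), by simp [hT], by simp⟩
      · exact ⟨(n + 1, n + 3), by simp [hT], (n + 2, n + 3), by simp [hT], by simp⟩

open Finset in
theorem IsRookCover.exists_card_eq : ∀ n : ℕ, 2 ≤ n →
    ∃ S, IsRookCover n S ∧ #S = if n % 4 = 2 then (3 * n + 1) / 2 + 1 else (3 * n + 1) / 2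
  | 0, h | 1, h => by omega
  | 2, _ => ⟨{(0, 0), (0, 1), (1, 0), (1, 1)}, ⟨by decide, by decide, by decide, by decide⟩, rfl⟩
  | 3, _ => ⟨{(0, 0), (0, 1), (0, 2), (1, 0), (2, 0)},
      ⟨by decide, by decide, by decide, by decide⟩, rfl⟩
  | 4, _ => IsRookCover.exists_add_four (n := 0) (m := 0) ⟨∅, by constructor <;> simp, rfl⟩
  | 5, _ => ⟨{(0, 0), (0, 1), (0, 2), (0, 4), (1, 3), (2, 3), (3, 3), (4, 3)},
      ⟨by decide, by decide, by decide, by decide⟩, rfl⟩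
  | n + 6, _ => by
    obtain ⟨S, hS, hcard⟩ := exists_add_four (exists_card_eq (n + 2) (by omega))
    refine ⟨S, hS, hcard.trans ?_⟩
    split_ifs <;> omega

open Finset in
theorem IsRookCover.exists_isKTDS {n : ℕ} {S : Finset (ℕ × ℕ)} (h : IsRookCover n S) :
    ∃ T : Set (Fin n × Fin n),
      IsKTDS ((⊤ : SimpleGraph (Fin n)) □ (⊤ : SimpleGraph (Fin n))) 2 T ∧ T.ncard = #S := by
  let f : Fin n × Fin n → ℕ × ℕ := Prod.map Fin.val Fin.val
  have hf : Function.Injective f := Fin.val_injective.prodMap Fin.val_injective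
  have hlift : ∀ p ∈ S, ∃ q, f q = p := fun p hp =>
    ⟨(⟨p.1, (h.subset p hp).1⟩, ⟨p.2, (h.subset p hp).2⟩), rfl⟩
  refine ⟨f ⁻¹' S, fun v => ?_, ?_⟩
  · suffices ∃ q ∈ S, ∃ r ∈ S, q ≠ r ∧ q ≠ f v ∧ r ≠ f v ∧
        (q.1 = (f v).1 ∨ q.2 = (f v).2) ∧ (r.1 = (f v).1 ∨ r.2 = (f v).2) by
      obtain ⟨q, hq, r, hr, hqr, hqv, hrv, hq', hr'⟩ := this
      obtain ⟨q, rfl⟩ := hlift q hq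
      obtain ⟨r, rfl⟩ := hlift r hr
      have hadj : ∀ p, f p ≠ f v → ((f p).1 = (f v).1 ∨ (f p).2 = (f v).2) →
          ((⊤ : SimpleGraph (Fin n)) □ (⊤ : SimpleGraph (Fin n))).Adj v p := by
        rintro ⟨a, b⟩ hne hp
        obtain ⟨c, d⟩ := v
        simp only [f, Prod.map_apply, ne_eq, Prod.mk.injEq, Fin.val_inj] at hne hp
        rw [SimpleGraph.boxProd_adj]
        simp only [SimpleGraph.top_adj]
        grind
      rw [← Set.ncard_pair (fun e => hqr (congrArg f e))]
      refine Set.ncard_le_ncard ?_ (Set.toFinite _)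
      rintro p (rfl | rfl)
      · exact ⟨hq, hadj _ hqv hq'⟩
      · exact ⟨hr, hadj _ hrv hr'⟩
    by_cases hv : f v ∈ S
    · exact h.two _ hv
    · obtain ⟨q, hq, hqv⟩ := h.row v.1 v.1.isLt
      obtain ⟨r, hr, hrv⟩ := h.col v.2 v.2.isLt
      have hqne : q ≠ f v := fun e => hv (e ▸ hq)
      refine ⟨q, hq, r, hr, ?_, hqne, fun e => hv (e ▸ hr), Or.inl hqv, Or.inr hrv⟩
      rintro rfl
      exact hqne (Prod.ext hqv hrv)
  · rw [Set.ncard_preimage_of_injective_subset_range hf fun p hp => hlift p hp,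
      Set.ncard_coe_finset]

theorem two_tuple_total_domination_rook_square (n : ℕ) (hn : 2 ≤ n) :
    kTotalDomNum ((⊤ : SimpleGraph (Fin n)) □ (⊤ : SimpleGraph (Fin n))) 2 =
      if n % 4 = 2 then ⌈(3 * (n : ℚ)) / 2⌉₊ + 1 else ⌈(3 * (n : ℚ)) / 2⌉₊ := by
  have hceil : ⌈(3 * (n : ℚ)) / 2⌉₊ = (3 * n + 1) / 2 := by
    refine eq_of_forall_ge_iff fun m => ?_
    rw [Nat.ceil_le, div_le_iff₀ two_pos]
    have : (3 * (n : ℚ) ≤ m * 2) ↔ 3 * n ≤ m * 2 := by norm_cast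
    rw [this]
    omega
  rw [hceil]
  refine IsLeast.csInf_eq ⟨?_, ?_⟩
  · obtain ⟨S, hS, hcard⟩ := IsRookCover.exists_card_eq n hn
    obtain ⟨T, hT, hTS⟩ := hS.exists_isKTDS
    exact ⟨T, hT, hTS.trans hcard⟩
  · rintro m ⟨S, hS, rfl⟩
    obtain ⟨S, rfl⟩ := S.toFinite.exists_finset_coe
    rw [Set.ncard_coe_finset]
    have := hS.rook_card_bound hn
    split_ifs <;> omega
end
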